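/- Assume k0 is continuous on [0,1]^p × [0,1]^p and let H0 be an RKHS on [0,1]^p with reproducing kernel k0. Call ν determining if for all Borel probability measures Q1, Q2 on [0,1]^p, Q1(A) = Q2(A) for ν-almost every A ∈ 𝒜 implies Q1 = Q2. Then H0 is dense in the Banach space C([0,1]^p, ℝ) of continuous real-valued functions with the supremum norm if and only if ν is determining. -/

import Mathlib

open MeasureTheory
open scoped ENNReal RealInnerProductSpace

noncomputable section

/-- Points of the unit cube `[0,1]^p`. -/
abbrev Pt (p : ℕ) : Type := Fin p → Set.Icc (0 : ℝ) 1

/-- Hyperrectangles `∏_j [a_j, b_j⟩` of `[0,1]^p`, encoded by the pair of endpoints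
`(a, b)` with `0 ≤ a_j < b_j ≤ 1`, viewed as a subtype of `(Fin p → ℝ) × (Fin p → ℝ)`
with the inherited sup metric (which is exactly the metric `ρ`) and its Borel σ-algebra. -/
abbrev HRect (p : ℕ) : Type :=
  {ab : (Fin p → ℝ) × (Fin p → ℝ) // ∀ j, 0 ≤ ab.1 j ∧ ab.1 j < ab.2 j ∧ ab.2 j ≤ 1}

/-- Membership `z ∈ [a, b⟩`: `a_j ≤ z_j` and (`z_j < b_j`, or `b_j = 1` in which case
`z_j ≤ b_j` holds automatically). -/
def memRect {p : ℕ} (z : Pt p) (A : HRect p) : Prop :=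
  ∀ j, A.1.1 j ≤ (z j : ℝ) ∧ ((z j : ℝ) < A.1.2 j ∨ A.1.2 j = 1)

/-- The indicator `1_A(z)`. -/
def ind {p : ℕ} (z : Pt p) (A : HRect p) : ℝ :=
  haveI := Classical.propDecidable (memRect z A)
  if memRect z A then 1 else 0

/-- The kernel `k0(z,z') = ∫ 1_A(z) 1_A(z') ν(dA)`. -/
def k0 {p : ℕ} (ν : Measure (HRect p)) (z z' : Pt p) : ℝ :=
  ∫ A, ind z A * ind z' A ∂ν

/-- `P(A)`: the measure of the hyperrectangle `A` under the first marginal of `P`. -/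
def PA {p : ℕ} (P : Measure (Pt p × ℝ)) (A : HRect p) : ℝ :=
  (P.fst {z | memRect z A}).toReal

/-- `α_P²(A) = 1/P(A)` if `P(A) > 0`, and `1` otherwise. -/
def alphaSq {p : ℕ} (P : Measure (Pt p × ℝ)) (A : HRect p) : ℝ :=
  haveI := Classical.propDecidable (0 < PA P A)
  if 0 < PA P A then 1 / PA P A else 1

/-- The kernel `k(z,z') = ∫ α_P²(A) 1_A(z) 1_A(z') ν(dA) ∈ [0,∞]`. -/
def kk {p : ℕ} (P : Measure (Pt p × ℝ)) (ν : Measure (HRect p)) (z z' : Pt p) : ℝ≥0∞ :=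
  ∫⁻ A, ENNReal.ofReal (alphaSq P A * ind z A * ind z' A) ∂ν

/-- A positive linear functional on `C(X, ℝ)`, `X` compact Hausdorff, is integration against a
finite measure. -/
lemma exists_integral_eq_of_nonneg {X : Type*} [TopologicalSpace X] [T2Space X] [CompactSpace X]
    [MeasurableSpace X] [BorelSpace X] (L : C(X, ℝ) →ₗ[ℝ] ℝ) (hL : ∀ f, 0 ≤ f → 0 ≤ L f) :
    ∃ μ : Measure X, IsFiniteMeasure μ ∧ ∀ f : C(X, ℝ), ∫ x, f x ∂μ = L f := by
  let T : CompactlySupportedContinuousMap X ℝ →ₗ[ℝ] C(X, ℝ) :=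
    { toFun := fun f => f.toContinuousMap
      map_add' := fun _ _ => rfl
      map_smul' := fun _ _ => rfl }
  let Λ := PositiveLinearMap.mk₀ (L ∘ₗ T) fun f hf => hL _ (show ∀ x, 0 ≤ f x from hf)
  have : IsFiniteMeasureOnCompacts (RealRMK.rieszMeasure Λ) := by
    unfold RealRMK.rieszMeasure; infer_instance
  refine ⟨RealRMK.rieszMeasure Λ, CompactSpace.isFiniteMeasure, fun f => ?_⟩
  exact RealRMK.integral_rieszMeasure Λ (CompactlySupportedContinuousMap.continuousMapEquiv f)

/-- A bounded linear functional on `C(X, ℝ)`, `X` compact Hausdorff, is a difference of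
integrations against finite measures. -/
lemma exists_integral_sub_integral_eq {X : Type*} [TopologicalSpace X] [T2Space X]
    [CompactSpace X] [Nonempty X] [MeasurableSpace X] [BorelSpace X]
    (Λ : StrongDual ℝ C(X, ℝ)) :
    ∃ μ₁ μ₂ : Measure X, IsFiniteMeasure μ₁ ∧ IsFiniteMeasure μ₂ ∧
      ∀ f : C(X, ℝ), ∫ x, f x ∂μ₁ - ∫ x, f x ∂μ₂ = Λ f := by
  obtain ⟨x₀⟩ := ‹Nonempty X›
  let E := C(X, ℝ) × C(X, ℝ)
  let W : Submodule ℝ E :=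
    (Submodule.span ℝ {(1 : C(X, ℝ))}).comap (LinearMap.fst ℝ _ _ + LinearMap.snd ℝ _ _)
  have hW : ∀ w : E, w ∈ W ↔ ∃ t : ℝ, t • (1 : C(X, ℝ)) = w.1 + w.2 := fun w => by
    simp only [W, Submodule.mem_comap, Submodule.mem_span_singleton]; rfl
  let ev₀ : C(X, ℝ) →ₗ[ℝ] ℝ := (ContinuousMap.evalCLM ℝ x₀).toLinearMap
  let l : E →ₗ[ℝ] ℝ :=
    (1 / 2 : ℝ) • (Λ.toLinearMap ∘ₗ (LinearMap.fst ℝ _ _ - LinearMap.snd ℝ _ _) +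
      ‖Λ‖ • (ev₀ ∘ₗ (LinearMap.fst ℝ _ _ + LinearMap.snd ℝ _ _)))
  have hl : ∀ w : E, l w = 1 / 2 * (Λ (w.1 - w.2) + ‖Λ‖ * (w.1 x₀ + w.2 x₀)) := fun w => rfl
  obtain ⟨g, hg, hpos⟩ := riesz_extension (PointedCone.positive ℝ E)
    (⟨W, l ∘ₗ W.subtype⟩ : E →ₗ.[ℝ] ℝ) (by
      rintro ⟨w, hw⟩ hw0
      obtain ⟨t, ht⟩ := (hW w).1 hw
      have hw0 : 0 ≤ w := by simpa using hw0
      have ht : ∀ x, w.1 x + w.2 x = t := fun x => by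
        simpa using (DFunLike.congr_fun ht x).symm
      have h1 : ∀ x, 0 ≤ w.1 x := hw0.1
      have h2 : ∀ x, 0 ≤ w.2 x := hw0.2
      have hn : ‖w.1 - w.2‖ ≤ t := by
        refine (ContinuousMap.norm_le _ (by linarith [h1 x₀, h2 x₀, ht x₀])).2 fun x => ?_
        rw [ContinuousMap.sub_apply, Real.norm_eq_abs, abs_le]
        constructor <;> linarith [h1 x, h2 x, ht x]
      change 0 ≤ l w
      rw [hl, ht]
      have h3 := (abs_le.1 (Λ.le_opNorm (w.1 - w.2))).1
      have h4 := mul_le_mul_of_nonneg_left hn (norm_nonneg Λ)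
      linarith) (by
      intro y
      let s : C(X, ℝ) := (‖y.1‖ + ‖y.2‖) • 1
      refine ⟨⟨(s, s), (hW _).2 ⟨2 * (‖y.1‖ + ‖y.2‖), by simp only [s, two_mul, add_smul]⟩⟩, ?_⟩
      rw [PointedCone.mem_positive]
      constructor
      · intro x
        have := (abs_le.1 (y.1.norm_coe_le_norm x)).1
        change 0 ≤ (‖y.1‖ + ‖y.2‖) * 1 + y.1 x
        linarith [norm_nonneg y.2]
      · intro x
        have := (abs_le.1 (y.2.norm_coe_le_norm x)).1
        change 0 ≤ (‖y.1‖ + ‖y.2‖) * 1 + y.2 x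
        linarith [norm_nonneg y.1])
  obtain ⟨μ₁, hμ₁, h1⟩ := exists_integral_eq_of_nonneg (g ∘ₗ LinearMap.inl ℝ _ _)
    fun f hf => hpos _ ((PointedCone.mem_positive ℝ E).2 ⟨hf, le_rfl⟩)
  obtain ⟨μ₂, hμ₂, h2⟩ := exists_integral_eq_of_nonneg (g ∘ₗ LinearMap.inr ℝ _ _)
    fun f hf => hpos _ ((PointedCone.mem_positive ℝ E).2 ⟨le_rfl, hf⟩)
  refine ⟨μ₁, μ₂, hμ₁, hμ₂, fun f => ?_⟩
  have h3 := hg ⟨(f, -f), (hW _).2 ⟨0, by simp⟩⟩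
  change g (f, -f) = l (f, -f) at h3
  have h4 : LinearMap.inl ℝ C(X, ℝ) C(X, ℝ) f - LinearMap.inr ℝ C(X, ℝ) C(X, ℝ) f = (f, -f) := by
    simp
  rw [h1, h2, LinearMap.comp_apply, LinearMap.comp_apply, ← map_sub, h4, h3, hl]
  simp only [ContinuousMap.neg_apply, sub_neg_eq_add, map_add]
  ring

/-- A non-dense subspace of `C(X, ℝ)` fails to separate two distinct finite measures. -/
lemma exists_integral_ne_of_not_dense {X : Type*} [TopologicalSpace X] [T2Space X]
    [CompactSpace X] [Nonempty X] [MeasurableSpace X] [BorelSpace X]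
    (D : Submodule ℝ C(X, ℝ)) (hD : ¬ Dense (D : Set C(X, ℝ))) :
    ∃ μ₁ μ₂ : Measure X, IsFiniteMeasure μ₁ ∧ IsFiniteMeasure μ₂ ∧ μ₁ ≠ μ₂ ∧
      ∀ f ∈ D, ∫ x, f x ∂μ₁ = ∫ x, f x ∂μ₂ := by
  obtain ⟨f₀, hf₀⟩ : ∃ f₀, f₀ ∉ closure (D : Set C(X, ℝ)) := by
    simpa [Dense] using hD
  obtain ⟨Λ, u, hu, huf⟩ := geometric_hahn_banach_closed_point
    (D.convex.closure) isClosed_closure hf₀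
  have hu0 : 0 < u := by simpa using hu 0 (subset_closure D.zero_mem)
  have hΛ : ∀ f ∈ D, Λ f = 0 := fun f hf => by
    by_contra h
    have := hu ((u / Λ f) • f) (subset_closure (D.smul_mem _ hf))
    rw [map_smul, smul_eq_mul, div_mul_cancel₀ _ h] at this
    exact lt_irrefl _ this
  obtain ⟨μ₁, μ₂, h1, h2, h⟩ := exists_integral_sub_integral_eq Λ
  refine ⟨μ₁, μ₂, h1, h2, ?_, fun f hf => sub_eq_zero.1 ((h f).trans (hΛ f hf))⟩
  rintro rfl
  have := h f₀
  rw [sub_self] at this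
  linarith

lemma continuous_integral_coe {X : Type*} [TopologicalSpace X] [CompactSpace X]
    [MeasurableSpace X] [BorelSpace X] (μ : Measure X) [IsFiniteMeasure μ] :
    Continuous fun f : C(X, ℝ) => ∫ x, f x ∂μ := by
  have hint : ∀ f : C(X, ℝ), Integrable f μ := fun f =>
    f.continuous.integrable_of_hasCompactSupport (.of_compactSpace _)
  refine (LipschitzWith.of_dist_le_mul (K := ⟨μ.real Set.univ, measureReal_nonneg⟩)
    fun f g => ?_).continuous
  rw [dist_eq_norm, dist_eq_norm, ← integral_sub (hint f) (hint g), mul_comm]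
  exact norm_integral_le_of_norm_le_const (ae_of_all _ fun x => (f - g).norm_coe_le_norm x)

lemma measurable_ind {p : ℕ} : Measurable fun q : Pt p × HRect p => ind q.1 q.2 := by
  classical
  have hs : MeasurableSet {q : Pt p × HRect p | memRect q.1 q.2} := by
    have hz : ∀ j, Measurable fun q : Pt p × HRect p => (q.1 j : ℝ) := fun j => by fun_prop
    have ha : ∀ j, Measurable fun q : Pt p × HRect p => q.2.1.1 j := fun j => by fun_prop
    have hb : ∀ j, Measurable fun q : Pt p × HRect p => q.2.1.2 j := fun j => by fun_prop
    simp only [memRect, Set.ofPred_forall, Set.ofPred_and, Set.ofPred_or]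
    exact MeasurableSet.iInter fun j => (measurableSet_le (ha j) (hz j)).inter
      ((measurableSet_lt (hz j) (hb j)).union (measurableSet_eq_fun (hb j) measurable_const))
  simpa only [ind] using Measurable.ite hs measurable_const measurable_const

lemma measurable_ind_left {p : ℕ} (A : HRect p) : Measurable fun z => ind z A :=
  measurable_ind.comp (measurable_id.prodMk measurable_const)

lemma measurable_ind_right {p : ℕ} (z : Pt p) : Measurable (ind z) :=
  measurable_ind.comp (measurable_const.prodMk measurable_id)

lemma norm_ind_le {p : ℕ} (z : Pt p) (A : HRect p) : ‖ind z A‖ ≤ 1 := by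
  unfold ind; split_ifs <;> simp

lemma integral_ind {p : ℕ} (Q : Measure (Pt p)) (A : HRect p) :
    ∫ z, ind z A ∂Q = Q.real {z | memRect z A} := by
  classical
  have hs : MeasurableSet {z | memRect z A} := by
    convert measurable_ind_left A (measurableSet_singleton (1 : ℝ)) using 1
    ext z
    simp [ind]
  rw [← integral_indicator_one hs]
  rfl

lemma integrable_of_norm_le_one {X : Type*} [MeasurableSpace X] {μ : Measure X}
    [IsFiniteMeasure μ] {f : X → ℝ} (hf : AEStronglyMeasurable f μ) (h : ∀ x, ‖f x‖ ≤ 1) :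
    Integrable f μ :=
  .of_bound hf 1 (ae_of_all _ h)

lemma norm_mul_le_one {a b : ℝ} (ha : ‖a‖ ≤ 1) (hb : ‖b‖ ≤ 1) : ‖a * b‖ ≤ 1 := by
  rw [norm_mul]; exact mul_le_one₀ ha (norm_nonneg b) hb

lemma integral_k0 {p : ℕ} (ν : Measure (HRect p)) [IsFiniteMeasure ν] (Q : Measure (Pt p))
    [IsFiniteMeasure Q] (x : Pt p) :
    ∫ y, k0 ν x y ∂Q = ∫ A, ind x A * Q.real {z | memRect z A} ∂ν := by
  unfold k0
  rw [integral_integral_swap]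
  · simp only [integral_const_mul, integral_ind]
  · exact integrable_of_norm_le_one
      (((measurable_ind_right x).comp measurable_snd).mul measurable_ind).aestronglyMeasurable
      fun q => norm_mul_le_one (norm_ind_le _ _) (norm_ind_le _ _)

lemma measurable_real_memRect {p : ℕ} (Q : Measure (Pt p)) [IsFiniteMeasure Q] :
    StronglyMeasurable fun A : HRect p => Q.real {z | memRect z A} := by
  simp only [← integral_ind]
  exact measurable_ind.stronglyMeasurable.integral_prod_left'

lemma integrable_real_mul_real {p : ℕ} (ν : Measure (HRect p)) [IsFiniteMeasure ν]
    (Q Q' : Measure (Pt p)) [IsFiniteMeasure Q] [IsFiniteMeasure Q'] :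
    Integrable (fun A => Q.real {z | memRect z A} * Q'.real {z | memRect z A}) ν := by
  refine .of_bound
    ((measurable_real_memRect Q).mul (measurable_real_memRect Q')).aestronglyMeasurable
    (Q.real Set.univ * Q'.real Set.univ) (ae_of_all _ fun A => ?_)
  rw [Real.norm_of_nonneg (by positivity)]
  exact mul_le_mul (measureReal_mono (Set.subset_univ _)) (measureReal_mono (Set.subset_univ _))
    measureReal_nonneg measureReal_nonneg

lemma integral_integral_k0 {p : ℕ} (ν : Measure (HRect p)) [IsFiniteMeasure ν]
    (Q Q' : Measure (Pt p)) [IsFiniteMeasure Q] [IsFiniteMeasure Q'] :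
    ∫ x, ∫ y, k0 ν x y ∂Q' ∂Q
      = ∫ A, Q.real {z | memRect z A} * Q'.real {z | memRect z A} ∂ν := by
  simp only [integral_k0]
  rw [integral_integral_swap]
  · simp only [integral_mul_const, integral_ind]
  · refine .of_bound (measurable_ind.stronglyMeasurable.mul
      ((measurable_real_memRect Q').comp_measurable measurable_snd)).aestronglyMeasurable
      (1 * Q'.real Set.univ) (ae_of_all _ fun q => ?_)
    simp only [Function.uncurry, norm_mul]
    gcongr
    · exact norm_ind_le _ _
    · rw [Real.norm_of_nonneg measureReal_nonneg]
      exact measureReal_mono (Set.subset_univ _)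

/-- Two finite measures with the same kernel mean embedding agree on `ν`-almost every
hyperrectangle. -/
lemma ae_real_memRect_eq {p : ℕ} (ν : Measure (HRect p)) [IsFiniteMeasure ν]
    (Q₁ Q₂ : Measure (Pt p)) [IsFiniteMeasure Q₁] [IsFiniteMeasure Q₂]
    (h : ∀ x, ∫ y, k0 ν x y ∂Q₁ = ∫ y, k0 ν x y ∂Q₂) :
    ∀ᵐ A ∂ν, Q₁.real {z | memRect z A} = Q₂.real {z | memRect z A} := by
  have h11 := integral_integral_k0 ν Q₁ Q₁
  have h12 := integral_integral_k0 ν Q₁ Q₂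
  have h21 := integral_integral_k0 ν Q₂ Q₁
  have h22 := integral_integral_k0 ν Q₂ Q₂
  simp only [h] at h11 h21
  have hcomm := integral_congr_ae (μ := ν) (ae_of_all _ fun A : HRect p =>
    mul_comm (Q₁.real {z | memRect z A}) (Q₂.real {z | memRect z A}))
  have hsq : ∀ A : HRect p, (Q₁.real {z | memRect z A} - Q₂.real {z | memRect z A}) ^ 2 =
      Q₁.real {z | memRect z A} * Q₁.real {z | memRect z A} -
      2 * (Q₁.real {z | memRect z A} * Q₂.real {z | memRect z A}) +
      Q₂.real {z | memRect z A} * Q₂.real {z | memRect z A} := fun A => by ring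
  have i11 := integrable_real_mul_real ν Q₁ Q₁
  have i12 := (integrable_real_mul_real ν Q₁ Q₂).const_mul 2
  have i22 := integrable_real_mul_real ν Q₂ Q₂
  have hint : Integrable (fun A : HRect p =>
      (Q₁.real {z | memRect z A} - Q₂.real {z | memRect z A}) ^ 2) ν := by
    simp only [hsq]
    exact (i11.sub i12).add i22
  have h0 : ∫ A, (Q₁.real {z | memRect z A} - Q₂.real {z | memRect z A}) ^ 2 ∂ν = 0 := by
    simp only [hsq]
    rw [integral_add (by exact i11.sub i12) i22, integral_sub i11 i12, integral_const_mul]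
    linarith
  filter_upwards [(integral_eq_zero_iff_of_nonneg (fun A => sq_nonneg _) hint).1 h0] with A hA
  exact sub_eq_zero.1 (pow_eq_zero_iff two_ne_zero |>.1 hA)

lemma real_univ_eq_integral {p : ℕ} (ν : Measure (HRect p)) [IsFiniteMeasure ν]
    (hnorm : ∀ z : Pt p, ∫ A, ind z A ∂ν = 1) (Q : Measure (Pt p)) [IsFiniteMeasure Q] :
    Q.real Set.univ = ∫ A, Q.real {z | memRect z A} ∂ν := by
  simp only [← integral_ind]
  rw [← integral_integral_swap]
  · simp [hnorm]
  · exact integrable_of_norm_le_one measurable_ind.aestronglyMeasurable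
      fun q => norm_ind_le _ _

/-- For `ν` determining, finite measures with the same kernel mean embedding coincide. -/
lemma eq_of_integral_k0_eq {p : ℕ} (ν : Measure (HRect p)) [IsFiniteMeasure ν]
    (hnorm : ∀ z : Pt p, ∫ A, ind z A ∂ν = 1)
    (hdet : ∀ Q1 Q2 : Measure (Pt p), IsProbabilityMeasure Q1 → IsProbabilityMeasure Q2 →
      (∀ᵐ A ∂ν, Q1 {z | memRect z A} = Q2 {z | memRect z A}) → Q1 = Q2)
    (Q₁ Q₂ : Measure (Pt p)) [IsFiniteMeasure Q₁] [IsFiniteMeasure Q₂]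
    (h : ∀ x, ∫ y, k0 ν x y ∂Q₁ = ∫ y, k0 ν x y ∂Q₂) : Q₁ = Q₂ := by
  have hae : ∀ᵐ A ∂ν, Q₁ {z | memRect z A} = Q₂ {z | memRect z A} :=
    (ae_real_memRect_eq ν Q₁ Q₂ h).mono fun A hA =>
      (measureReal_eq_measureReal_iff).1 hA
  have hmass : Q₁ Set.univ = Q₂ Set.univ := by
    rw [← measureReal_eq_measureReal_iff, real_univ_eq_integral ν hnorm,
      real_univ_eq_integral ν hnorm]
    exact integral_congr_ae (ae_real_memRect_eq ν Q₁ Q₂ h)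
  by_cases h0 : Q₂ Set.univ = 0
  · rw [Measure.measure_univ_eq_zero.1 h0, Measure.measure_univ_eq_zero.1 (hmass.trans h0)]
  have htop := measure_ne_top Q₂ Set.univ
  have heq := hdet ((Q₂ Set.univ)⁻¹ • Q₁) ((Q₂ Set.univ)⁻¹ • Q₂)
    ⟨by simp [hmass, ENNReal.inv_mul_cancel h0 htop]⟩
    ⟨by simp [ENNReal.inv_mul_cancel h0 htop]⟩
    (hae.mono fun A hA => by simp [hA])
  have := congrArg (Q₂ Set.univ • ·) heq
  simpa [smul_smul, ENNReal.mul_inv_cancel h0 htop] using this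

lemma continuous_feature {p : ℕ} {ν : Measure (HRect p)}
    (hcont : Continuous fun zz : Pt p × Pt p => k0 ν zz.1 zz.2)
    {H : Type*} [NormedAddCommGroup H] [InnerProductSpace ℝ H] {Kf : Pt p → H}
    (hker : ∀ x y : Pt p, k0 ν x y = ⟪Kf x, Kf y⟫) : Continuous Kf := by
  refine continuous_iff_continuousAt.2 fun x => tendsto_iff_norm_sub_tendsto_zero.2 ?_
  have hsq : ∀ y, ‖Kf y - Kf x‖ = √(k0 ν y y - 2 * k0 ν y x + k0 ν x x) := fun y => by
    rw [hker, hker, hker, real_inner_self_eq_norm_sq, real_inner_self_eq_norm_sq,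
      ← norm_sub_sq_real, Real.sqrt_sq (norm_nonneg _)]
  have hd : Continuous fun y => k0 ν y y := hcont.comp (continuous_id.prodMk continuous_id)
  have hx : Continuous fun y => k0 ν y x := hcont.comp (continuous_id.prodMk continuous_const)
  have hc : Continuous fun y => ‖Kf y - Kf x‖ := by
    simp only [hsq]
    exact ((hd.sub (hx.const_mul 2)).add continuous_const).sqrt
  simpa using hc.tendsto x

/-- assume `k0` is continuous and let `H0` be an RKHS on `[0,1]^p`
with reproducing kernel `k0` (given by a Hilbert space `H`, an injective linear
realization `ev` and kernel features `Kf`).  Then (the realization of) `H0` is dense in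
`C([0,1]^p, ℝ)` iff `ν` is determining. -/
theorem stmt12 {p : ℕ} (ν : Measure (HRect p)) [IsFiniteMeasure ν]
    (hnorm : ∀ z : Pt p, ∫ A, ind z A ∂ν = 1)
    (hcont : Continuous fun zz : Pt p × Pt p => k0 ν zz.1 zz.2)
    {H : Type} [NormedAddCommGroup H] [InnerProductSpace ℝ H] [CompleteSpace H]
    (ev : H →ₗ[ℝ] (Pt p → ℝ)) (hinj : Function.Injective ev)
    (Kf : Pt p → H)
    (hrep : ∀ (x : Pt p) (F : H), ⟪Kf x, F⟫ = ev F x)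
    (hker : ∀ x y : Pt p, k0 ν x y = ⟪Kf x, Kf y⟫) :
    Dense {g : ContinuousMap (Pt p) ℝ | ∃ F : H, ∀ z : Pt p, g z = ev F z}
      ↔ (∀ Q1 Q2 : Measure (Pt p), IsProbabilityMeasure Q1 → IsProbabilityMeasure Q2 →
          (∀ᵐ A ∂ν, Q1 {z | memRect z A} = Q2 {z | memRect z A}) → Q1 = Q2) := by
  have hKf := continuous_feature hcont hker
  have hint : ∀ (Q : Measure (Pt p)) [IsFiniteMeasure Q], Integrable Kf Q := fun Q _ =>
    hKf.integrable_of_hasCompactSupport (HasCompactSupport.of_compactSpace _)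
  constructor
  · intro hdense Q₁ Q₂ _ _ hae
    have hmean : ∫ y, Kf y ∂Q₁ = ∫ y, Kf y ∂Q₂ := by
      refine hinj (funext fun x => ?_)
      rw [← hrep, ← hrep, ← integral_inner (hint Q₁), ← integral_inner (hint Q₂)]
      simp only [← hker, integral_k0]
      exact integral_congr_ae (hae.mono fun A hA => by simp only [measureReal_def, hA])
    have hev : ∀ (Q : Measure (Pt p)) [IsFiniteMeasure Q] (F : H),
        ∫ z, ev F z ∂Q = ⟪F, ∫ y, Kf y ∂Q⟫ := fun Q _ F => by
      rw [← integral_inner (hint Q)]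
      simp only [← hrep, real_inner_comm]
    have heq := (continuous_integral_coe Q₁).ext_on hdense (continuous_integral_coe Q₂) (by
      rintro g ⟨F, hF⟩
      simp only [hF, hev, hmean])
    exact ext_of_forall_integral_eq_of_IsFiniteMeasure fun f =>
      congrFun heq f.toContinuousMap
  · intro hdet
    let D : Submodule ℝ C(Pt p, ℝ) :=
      (LinearMap.range ev).comap (ContinuousMap.coeFnLinearMap ℝ)
    have hD : {g : C(Pt p, ℝ) | ∃ F : H, ∀ z : Pt p, g z = ev F z} = D := by
      ext g
      exact exists_congr fun F => funext_iff.symm.trans eq_comm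
    rw [hD]
    by_contra hdense
    obtain ⟨μ₁, μ₂, _, _, hne, hμ⟩ := exists_integral_ne_of_not_dense D hdense
    refine hne (eq_of_integral_k0_eq ν hnorm hdet μ₁ μ₂ fun x => ?_)
    exact hμ ⟨fun y => k0 ν x y, hcont.comp (continuous_const.prodMk continuous_id)⟩
      (hD.subset ⟨Kf x, fun y => by
        rw [← hrep, ← hker]
        simp only [ContinuousMap.coe_mk, hker, real_inner_comm]⟩)

end
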